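/- arXiv:1707.03486 — 7 statements merged into one kernel-verified Lean document; each statement's English description precedes it below -/
import Mathlib

section
/- Let (K, k) be a pair of algebraically closed fields. Fix m, n ∈ ℕ, r ≥ 1, polynomials P₁,…,P_r, Q ∈ ℤ[X₁,…,X_m, Y₁,…,Y_n, Z], and a ∈ K^n, and let S = {b ∈ K : there exists u ∈ k^m with P₁(u,a,b) = ⋯ = P_r(u,a,b) = 0 and Q(u,a,b) ≠ 0}. If there is no u ∈ k^m such that P_i(u,a,Z) is the zero polynomial in K[Z] for all i = 1,…,r while Q(u,a,Z) is not the zero polynomial in K[Z], then every b ∈ S is algebraic over the subfield of K generated by k ∪ {a₁,…,a_n}. -/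
/-- Evaluate an integer polynomial `P ∈ ℤ[X₁,…,X_m, Y₁,…,Y_n, Z]` at `u ∈ K^m`, `a ∈ K^n`
in the `X`- and `Y`-variables, leaving `Z` as the variable, yielding `P(u,a,Z) ∈ K[Z]`. -/
noncomputable def polyEvalZ {K : Type*} [Field K] {m n : ℕ}
    (P : MvPolynomial (Fin m ⊕ Fin n ⊕ Unit) ℤ) (u : Fin m → K) (a : Fin n → K) :
    Polynomial K :=
  MvPolynomial.aeval (Sum.elim (fun i => Polynomial.C (u i))
    (Sum.elim (fun j => Polynomial.C (a j)) (fun _ => Polynomial.X))) P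

/-- Let `(K, k)` be a pair of algebraically closed fields. For `P₁,…,P_r, Q` integer
polynomials and `a ∈ K^n`, let `S` be the very special set they define. If there is no
`u ∈ k^m` with all `P_i(u,a,Z)` equal to the zero polynomial of `K[Z]` while `Q(u,a,Z)`
is nonzero, then every `b ∈ S` is algebraic over the subfield of `K` generated by
`k ∪ {a₁,…,a_n}`. -/
theorem verySpecial_algebraic {K : Type*} [Field K] [IsAlgClosed K]
    (k : Subfield K) [IsAlgClosed k] (hk : k ≠ ⊤)
    (m n r : ℕ) (hr : 1 ≤ r)
    (P : Fin r → MvPolynomial (Fin m ⊕ Fin n ⊕ Unit) ℤ)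
    (Q : MvPolynomial (Fin m ⊕ Fin n ⊕ Unit) ℤ) (a : Fin n → K)
    (S : Set K)
    (hS : S = {b : K | ∃ v : Fin m → K, (∀ i, v i ∈ k) ∧
      (∀ i : Fin r, (polyEvalZ (P i) v a).eval b = 0) ∧ (polyEvalZ Q v a).eval b ≠ 0})
    (hno : ¬ ∃ u : Fin m → K, (∀ i, u i ∈ k) ∧
      (∀ i : Fin r, polyEvalZ (P i) u a = 0) ∧ polyEvalZ Q u a ≠ 0) :
    ∀ b ∈ S, IsAlgebraic (Subfield.closure ((k : Set K) ∪ Set.range a)) b := by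
  intro b hb
  rw [hS] at hb
  obtain ⟨v, hv, hP, hQ⟩ := hb
  have hQ0 : polyEvalZ Q v a ≠ 0 := by
    intro h
    apply hQ
    rw [h, Polynomial.eval_zero]
  have hex : ∃ i, polyEvalZ (P i) v a ≠ 0 := by
    by_contra hcon
    push Not at hcon
    exact hno ⟨v, hv, hcon, hQ0⟩
  obtain ⟨i, hi⟩ := hex
  set F := Subfield.closure ((k : Set K) ∪ Set.range a) with hF
  let v' : Fin m → F := fun j => ⟨v j, Subfield.subset_closure (Or.inl (hv j))⟩
  let a' : Fin n → F := fun j => ⟨a j, Subfield.subset_closure (Or.inr ⟨j, rfl⟩)⟩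
  have key : (polyEvalZ (P i) v' a').map (algebraMap F K) = polyEvalZ (P i) v a := by
    unfold polyEvalZ
    induction P i using MvPolynomial.induction_on with
    | C c => simp
    | add p q hp hq => rw [map_add, map_add, Polynomial.map_add, hp, hq]
    | mul_X p x hp =>
      rw [map_mul, map_mul, Polynomial.map_mul, hp, MvPolynomial.aeval_X, MvPolynomial.aeval_X]
      congr 1
      rcases x with x | x | x
      · simp [v']; rfl
      · simp [a']; rfl
      · simp
  refine ⟨polyEvalZ (P i) v' a', ?_, ?_⟩
  · intro h
    apply hi
    rw [← key, h, Polynomial.map_zero]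
  · rw [← Polynomial.eval_map_algebraMap, key]
    exact hP i
end

section
/- Let (K, k) be a pair of algebraically closed fields. Suppose S ⊆ K is a finite union of sets of the form V₀ ∩ (K ∖ V₁) ∩ ⋯ ∩ (K ∖ V_r), where each V_j is a very special set in (K, k). Then there exist N ∈ ℕ and c₁,…,c_N ∈ K such that either every element of S is algebraic over the subfield of K generated by k ∪ {c₁,…,c_N}, or every element of K ∖ S is algebraic over the subfield of K generated by k ∪ {c₁,…,c_N}. -/
/-- A very special set in the pair `(K, k)`: the set of `b ∈ K` such that for some
`u ∈ k^m` one has `P₁(u,a,b) = ⋯ = P_r(u,a,b) = 0` and `Q(u,a,b) ≠ 0`. -/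
def VerySpecial {K : Type*} [Field K] (k : Subfield K) (V : Set K) : Prop :=
  ∃ (m n r : ℕ), 1 ≤ r ∧
    ∃ (P : Fin r → MvPolynomial (Fin m ⊕ Fin n ⊕ Unit) ℤ)
      (Q : MvPolynomial (Fin m ⊕ Fin n ⊕ Unit) ℤ) (a : Fin n → K),
      V = {b : K | ∃ u : Fin m → K, (∀ i, u i ∈ k) ∧
        (∀ i : Fin r, (polyEvalZ (P i) u a).eval b = 0) ∧ (polyEvalZ Q u a).eval b ≠ 0}

theorem vs_map_aux {K : Type*} [Field K] {m n : ℕ} (E : Subfield K)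
    (P : MvPolynomial (Fin m ⊕ Fin n ⊕ Unit) ℤ) (u : Fin m → E) (a : Fin n → E) :
    (polyEvalZ P u a).map (algebraMap E K) = polyEvalZ P (fun i => (u i : K)) (fun i => (a i : K)) := by
  unfold polyEvalZ
  have h := MvPolynomial.map_aeval (Sum.elim (fun i => Polynomial.C (u i))
    (Sum.elim (fun j => Polynomial.C (a j)) (fun _ => Polynomial.X)))
    (Polynomial.mapRingHom (algebraMap E K)) P
  rw [Polynomial.coe_mapRingHom] at h
  rw [h, MvPolynomial.aeval_def, MvPolynomial.coe_eval₂Hom]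
  congr 1
  · exact RingHom.ext_int _ _
  · funext x
    rcases x with i | j | x
    · simp; rfl
    · simp; rfl
    · simp

theorem vs_eval_aux {K : Type*} [Field K] {m n : ℕ} (E : Subfield K)
    (P : MvPolynomial (Fin m ⊕ Fin n ⊕ Unit) ℤ) (u : Fin m → K) (a : Fin n → K)
    (hu : ∀ i, u i ∈ E) (ha : ∀ i, a i ∈ E) (b : K) (hb : ¬ IsAlgebraic E b) :
    (polyEvalZ P u a).eval b = 0 ↔ polyEvalZ P u a = 0 := by
  have h := vs_map_aux E P (fun i => ⟨u i, hu i⟩) (fun i => ⟨a i, ha i⟩)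
  simp only at h
  constructor
  · intro h0
    rw [← h, Polynomial.eval_map_algebraMap] at h0
    by_contra hne
    refine hb ⟨_, ?_, h0⟩
    intro hz
    rw [hz, Polynomial.map_zero] at h
    exact hne h.symm
  · intro h0
    rw [h0, Polynomial.eval_zero]

theorem vs_generic {K : Type*} [Field K] (k : Subfield K) (V : Set K) (hV : VerySpecial k V) :
    ∃ T : Set K, T.Finite ∧ ∀ E : Subfield K, k ≤ E → T ⊆ E → ∀ b b' : K,
      ¬ IsAlgebraic E b → ¬ IsAlgebraic E b' → b ∈ V → b' ∈ V := by
  obtain ⟨m, n, r, -, P, Q, a, rfl⟩ := hV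
  refine ⟨Set.range a, Set.finite_range a, ?_⟩
  rintro E hkE hT b b' hb hb' ⟨u, hu, hP, hQ⟩
  have hu' : ∀ i, u i ∈ E := fun i => hkE (hu i)
  have ha' : ∀ i, a i ∈ E := fun i => hT ⟨i, rfl⟩
  refine ⟨u, hu, fun i => ?_, ?_⟩
  · rw [vs_eval_aux E _ u a hu' ha' b' hb', ← vs_eval_aux E _ u a hu' ha' b hb]
    exact hP i
  · rw [Ne, vs_eval_aux E _ u a hu' ha' b' hb', ← vs_eval_aux E _ u a hu' ha' b hb]
    exact hQ

/-- Dichotomy for boolean combinations of very special sets in a pair `(K, k)` of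
algebraically closed fields: if `S ⊆ K` is a finite union of sets of the form
`V₀ ∩ (K ∖ V₁) ∩ ⋯ ∩ (K ∖ V_r)` with each `V_j` very special, then there are finitely many
`c₁,…,c_N ∈ K` such that either every element of `S`, or every element of `K ∖ S`, is
algebraic over the subfield of `K` generated by `k ∪ {c₁,…,c_N}`. -/
theorem verySpecial_boolean_dichotomy {K : Type*} [Field K] [IsAlgClosed K]
    (k : Subfield K) [IsAlgClosed k] (hk : k ≠ ⊤) (S : Set K)
    (hS : ∃ (N : ℕ) (r : Fin N → ℕ) (V : Fin N → Set K)
        (W : (j : Fin N) → Fin (r j) → Set K),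
      (∀ j, VerySpecial k (V j)) ∧ (∀ j i, VerySpecial k (W j i)) ∧
      S = ⋃ j, (V j ∩ ⋂ i, (W j i)ᶜ)) :
    ∃ (N : ℕ) (c : Fin N → K),
      (∀ b ∈ S, IsAlgebraic (Subfield.closure ((k : Set K) ∪ Set.range c)) b) ∨
      (∀ b ∈ Sᶜ, IsAlgebraic (Subfield.closure ((k : Set K) ∪ Set.range c)) b) := by
  obtain ⟨N, r, V, W, hV, hW, rfl⟩ := hS
  choose T hTf hT using fun j => vs_generic k (V j) (hV j)
  choose U hUf hU using fun j i => vs_generic k (W j i) (hW j i)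
  have hfin : ((⋃ j, T j) ∪ ⋃ j, ⋃ i, U j i).Finite :=
    (Set.finite_iUnion hTf).union (Set.finite_iUnion fun j => Set.finite_iUnion (hUf j))
  obtain ⟨M, c, -, hc⟩ := hfin.fin_param
  refine ⟨M, c, ?_⟩
  set E := Subfield.closure ((k : Set K) ∪ Set.range c) with hE
  have hsub : (k : Set K) ∪ Set.range c ⊆ E := Subfield.subset_closure
  have hkE : k ≤ E := fun x hx => hsub (Or.inl hx)
  have hTE : ∀ j, T j ⊆ E := fun j x hx =>
    hsub (Or.inr (hc ▸ Or.inl (Set.mem_iUnion.2 ⟨j, hx⟩)))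
  have hUE : ∀ j i, U j i ⊆ E := fun j i x hx =>
    hsub (Or.inr (hc ▸ Or.inr (Set.mem_iUnion.2 ⟨j, Set.mem_iUnion.2 ⟨i, hx⟩⟩)))
  by_contra! hcon
  obtain ⟨⟨b, hbS, hb⟩, b', hbS', hb'⟩ := hcon
  apply hbS'
  obtain ⟨j, hj, hjW⟩ := Set.mem_iUnion.1 hbS
  refine Set.mem_iUnion.2 ⟨j, hT j E hkE (hTE j) b b' hb hb' hj, ?_⟩
  refine Set.mem_iInter.2 fun i hi => ?_
  exact Set.mem_iInter.1 hjW i (hU j i E hkE (hUE j i) b' b hb' hb hi)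
end

section
/- Let K be a field and k a subfield of K with |K| > max(|k|, ℵ₀). Then K is not a finite union of Φ₂-sets: there is no finite family of pairs (P_j, a_j), with P_j ∈ ℤ[X₁,…,X_{m_j}, Y₁,…,Y_{n_j}, Z] and a_j ∈ K^{n_j}, such that every b ∈ K satisfies, for some j and some u ∈ k^{m_j}, P_j(u, a_j, b) = 0 and P_j(u, a_j, Z) not identically zero in K[Z]. -/
/-- If `k` is a subfield of `K` with `|K| > max(|k|, ℵ₀)`, then `K` is not a finite union
of Φ₂-sets: there is no finite family of integer polynomials `P_j` and parameter tuples
`a_j ∈ K^{n_j}` such that every `b ∈ K` satisfies `P_j(u, a_j, b) = 0` for some `j` and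
some `u ∈ k^{m_j}` with `P_j(u, a_j, Z)` not identically zero in `K[Z]`. -/
theorem not_finite_union_phi2 {K : Type*} [Field K] (k : Subfield K)
    (hcard : max (Cardinal.mk k) Cardinal.aleph0 < Cardinal.mk K) :
    ¬ ∃ (N : ℕ) (m n : Fin N → ℕ)
        (P : (j : Fin N) → MvPolynomial (Fin (m j) ⊕ Fin (n j) ⊕ Unit) ℤ)
        (a : (j : Fin N) → Fin (n j) → K),
      ∀ b : K, ∃ (j : Fin N) (u : Fin (m j) → K), (∀ i, u i ∈ k) ∧
        polyEvalZ (P j) u (a j) ≠ 0 ∧ (polyEvalZ (P j) u (a j)).eval b = 0 := by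
  rintro ⟨N, m, n, P, a, h⟩
  set M := max (Cardinal.mk k) Cardinal.aleph0 with hM
  have hM0 : Cardinal.aleph0 ≤ M := le_max_right _ _
  let F : (Σ j : Fin N, (Fin (m j) → k)) → Set K := fun x =>
    {b | polyEvalZ (P x.1) (fun i => (x.2 i : K)) (a x.1) ≠ 0 ∧
      (polyEvalZ (P x.1) (fun i => (x.2 i : K)) (a x.1)).eval b = 0}
  have hF : ∀ x, Cardinal.mk (F x) ≤ M := by
    intro x
    refine le_trans ?_ hM0
    rw [Cardinal.mk_le_aleph0_iff, Set.countable_coe_iff]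
    by_cases hp : polyEvalZ (P x.1) (fun i => (x.2 i : K)) (a x.1) = 0
    · have : F x = ∅ := by
        ext b
        simp [F, hp]
      rw [this]
      exact Set.countable_empty
    · refine ((Polynomial.finite_setOf_isRoot hp).subset ?_).countable
      intro b hb
      exact hb.2
  have hU : (⋃ x, F x) = Set.univ := by
    rw [Set.eq_univ_iff_forall]
    intro b
    obtain ⟨j, u, hu, h1, h2⟩ := h b
    exact Set.mem_iUnion.2 ⟨⟨j, fun i => ⟨u i, hu i⟩⟩, h1, h2⟩
  have hI : Cardinal.mk (Σ j : Fin N, (Fin (m j) → k)) ≤ M := by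
    have hinj : Function.Injective
        (fun x : (Σ j : Fin N, (Fin (m j) → k)) => ((x.1 : ℕ), List.ofFn x.2)) := by
      rintro ⟨j, u⟩ ⟨j', u'⟩ hx
      simp only [Prod.mk.injEq] at hx
      obtain ⟨hj, hl⟩ := hx
      obtain rfl := Fin.ext hj
      rw [List.ofFn_injective hl]
    refine (Cardinal.mk_le_of_injective hinj).trans ?_
    rw [Cardinal.mk_prod]
    refine Cardinal.mul_le_of_le hM0 (by simpa using hM0) ?_
    rw [Cardinal.lift_uzero]
    exact (Cardinal.mk_list_le_max _).trans (by rw [max_comm])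
  have hK : Cardinal.mk K ≤ M := by
    rw [← Cardinal.mk_univ, ← hU]
    refine (Cardinal.mk_iUnion_le_sum_mk).trans ?_
    refine (Cardinal.sum_le_sum _ _ hF).trans ?_
    rw [Cardinal.sum_const']
    exact Cardinal.mul_le_of_le hM0 hI le_rfl
  exact absurd hcard (not_lt.2 hK)
end

section
/- Let L be a first-order language, M an L-structure, and D ⊆ M a 0-definable set with at least two elements. Suppose there is a definable total ordering on M, i.e. a definable set O ⊆ M² which is the graph of a linear order on M. If S ⊆ M^n is definable and almost internal to D, then S is internal to D. -/
open FirstOrder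

/-- `S ⊆ M^n` is internal to `D`: there are a definable `E ⊆ D^m` and a definable map
`f : E → M^n` (given by its definable graph `G`) with `f(E) = S`. -/
def Internal (L : Language) (M : Type*) [L.Structure M] (D : Set M) {n : ℕ}
    (S : Set (Fin n → M)) : Prop :=
  ∃ (m : ℕ) (E : Set (Fin m → M)) (G : Set (Fin (m + n) → M)),
    Set.Definable (Set.univ : Set M) L E ∧
    Set.Definable (Set.univ : Set M) L G ∧
    (∀ e ∈ E, ∀ i, e i ∈ D) ∧
    (∀ x ∈ G, (fun i => x (Fin.castAdd n i)) ∈ E) ∧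
    (∀ e ∈ E, ∃! s : Fin n → M, Fin.append e s ∈ G) ∧
    S = {s : Fin n → M | ∃ e ∈ E, Fin.append e s ∈ G}

/-- `S ⊆ M^n` is almost internal to `D`: there are a definable `E ⊆ D^m` and a definable
relation `R ⊆ E × S` whose sections `R(e)` all have at most `d` elements, with
`⋃_{e ∈ E} R(e) = S`. -/
def AlmostInternal (L : Language) (M : Type*) [L.Structure M] (D : Set M) {n : ℕ}
    (S : Set (Fin n → M)) : Prop :=
  ∃ (m d : ℕ) (E : Set (Fin m → M)) (R : Set (Fin (m + n) → M)),
    Set.Definable (Set.univ : Set M) L E ∧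
    Set.Definable (Set.univ : Set M) L R ∧
    (∀ e ∈ E, ∀ i, e i ∈ D) ∧
    (∀ x ∈ R, (fun i => x (Fin.castAdd n i)) ∈ E ∧ (fun i => x (Fin.natAdd m i)) ∈ S) ∧
    (∀ e ∈ E, {s : Fin n → M | Fin.append e s ∈ R}.Finite ∧
      {s : Fin n → M | Fin.append e s ∈ R}.ncard ≤ d) ∧
    S = {s : Fin n → M | ∃ e ∈ E, Fin.append e s ∈ R}


namespace AIproof

/-- Tuples in `R` whose second part is not lexicographically minimal in its section. -/
def bad {M : Type*} [LinearOrder M] {m n : ℕ} (R : Set (Fin (m + n) → M)) :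
    Set (Fin (m + n) → M) :=
  {v | ∃ t : Fin n → M, Fin.append (fun i => v (Fin.castAdd n i)) t ∈ R ∧
    toLex t < toLex (fun i => v (Fin.natAdd m i))}

/-- Iterated removal of the minimal element of each section. -/
def chain {M : Type*} [LinearOrder M] {m n : ℕ} (R : Set (Fin (m + n) → M)) :
    ℕ → Set (Fin (m + n) → M)
  | 0 => R
  | k + 1 => chain R k ∩ bad (chain R k)

theorem def_eq {L : Language} {M : Type*} [L.Structure M] {α : Type*} (i j : α) :
    Set.Definable (Set.univ : Set M) L {v : α → M | v i = v j} :=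
  ⟨(Language.Term.var i).equal (Language.Term.var j), by ext v; simp⟩

theorem def_const {L : Language} {M : Type*} [L.Structure M] {α : Type*} (i : α) (a : M) :
    Set.Definable (Set.univ : Set M) L {v : α → M | v i = a} :=
  ⟨(Language.Term.var i).equal
    (Language.Constants.term (L.con (⟨a, trivial⟩ : (Set.univ : Set M)))), by ext v; simp⟩

theorem bad_def {L : Language} {M : Type*} [L.Structure M] [LinearOrder M]
    (hle : Set.Definable (Set.univ : Set M) L {v : Fin 2 → M | v 0 ≤ v 1}) {m n : ℕ}
    {R : Set (Fin (m + n) → M)} (hR : Set.Definable (Set.univ : Set M) L R) :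
    Set.Definable (Set.univ : Set M) L (bad R) := by
  have h1 : Set.Definable (Set.univ : Set M) L
      {w : Fin (m + n) ⊕ Fin n → M |
        Fin.append (fun i => w (Sum.inl (Fin.castAdd n i))) (fun i => w (Sum.inr i)) ∈ R} := by
    have := hR.preimage_comp
      (Fin.append (fun i => (Sum.inl (Fin.castAdd n i) : Fin (m + n) ⊕ Fin n)) Sum.inr)
    convert this using 1
    ext w
    simp only [Set.mem_ofPred_eq, Set.mem_preimage]
    apply Iff.of_eq
    congr 1
    ext i
    refine Fin.addCases (fun i => ?_) (fun i => ?_) i <;> simp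
  have hlt : ∀ a b : Fin (m + n) ⊕ Fin n, Set.Definable (Set.univ : Set M) L
      {w : Fin (m + n) ⊕ Fin n → M | w a < w b} := by
    intro a b
    have := (hle.preimage_comp (![b, a])).compl
    convert this using 1
    ext w
    simp
  have h2 : Set.Definable (Set.univ : Set M) L
      {w : Fin (m + n) ⊕ Fin n → M |
        toLex (fun i => w (Sum.inr i)) < toLex (fun i => w (Sum.inl (Fin.natAdd m i)))} := by
    have : {w : Fin (m + n) ⊕ Fin n → M |
        toLex (fun i => w (Sum.inr i)) < toLex (fun i => w (Sum.inl (Fin.natAdd m i)))} =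
        ⋃ i : Fin n, ((⋂ j : {j : Fin n // j < i},
          {w | w (Sum.inr j.1) = w (Sum.inl (Fin.natAdd m j.1))}) ∩
          {w | w (Sum.inr i) < w (Sum.inl (Fin.natAdd m i))}) := by
      ext w
      simp only [Set.mem_ofPred_eq, Set.mem_iUnion, Set.mem_inter_iff, Set.mem_iInter]
      constructor
      · rintro ⟨i, h, h'⟩
        exact ⟨i, fun j => h j.1 j.2, h'⟩
      · rintro ⟨i, h, h'⟩
        exact ⟨i, fun j hj => h ⟨j, hj⟩, h'⟩
    rw [this]
    exact Set.definable_iUnion_of_finite fun i =>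
      (Set.definable_iInter_of_finite fun j => def_eq _ _).inter (hlt _ _)
  exact (h1.inter h2).exists_of_finite

theorem chain_def {L : Language} {M : Type*} [L.Structure M] [LinearOrder M]
    (hle : Set.Definable (Set.univ : Set M) L {v : Fin 2 → M | v 0 ≤ v 1}) {m n : ℕ}
    {R : Set (Fin (m + n) → M)} (hR : Set.Definable (Set.univ : Set M) L R) (k : ℕ) :
    Set.Definable (Set.univ : Set M) L (chain R k) := by
  induction k with
  | zero => exact hR
  | succ k ih => exact ih.inter (bad_def hle ih)

theorem append_mem_bad {M : Type*} [LinearOrder M] {m n : ℕ} (R : Set (Fin (m + n) → M))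
    (e : Fin m → M) (s : Fin n → M) : Fin.append e s ∈ bad R ↔
    ∃ t : Fin n → M, Fin.append e t ∈ R ∧ toLex t < toLex s := by
  simp [bad]

theorem chain_card {M : Type*} [LinearOrder M] {m n d : ℕ} (R : Set (Fin (m + n) → M))
    (e : Fin m → M) (hf : {s : Fin n → M | Fin.append e s ∈ R}.Finite)
    (hc : {s : Fin n → M | Fin.append e s ∈ R}.ncard ≤ d) (k : ℕ) :
    {s : Fin n → M | Fin.append e s ∈ chain R k}.Finite ∧
    {s : Fin n → M | Fin.append e s ∈ chain R k}.ncard ≤ d - k := by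
  induction k with
  | zero => exact ⟨hf, hc⟩
  | succ k ih =>
    obtain ⟨h1, h2⟩ := ih
    have hsub : {s : Fin n → M | Fin.append e s ∈ chain R (k + 1)} ⊆
        {s : Fin n → M | Fin.append e s ∈ chain R k} := fun s hs => hs.1
    refine ⟨h1.subset hsub, ?_⟩
    rcases Set.eq_empty_or_nonempty {s : Fin n → M | Fin.append e s ∈ chain R k} with h0 | h0
    · rw [h0] at hsub
      rw [Set.subset_empty_iff.mp hsub]
      simp
    · obtain ⟨s, hs, hmin⟩ := Set.exists_min_image _ (fun s => toLex s) h1 h0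
      have : {s : Fin n → M | Fin.append e s ∈ chain R (k + 1)} ⊂
          {s : Fin n → M | Fin.append e s ∈ chain R k} := by
        refine ⟨hsub, fun h => ?_⟩
        obtain ⟨t, ht, hlt⟩ := (append_mem_bad _ _ _).1 (h hs).2
        exact absurd (hmin t ht) (not_le.mpr hlt)
      have := Set.ncard_lt_ncard this h1
      omega

theorem chain_anti {M : Type*} [LinearOrder M] {m n : ℕ} (R : Set (Fin (m + n) → M)) (k : ℕ) :
    chain R k ⊆ R := by
  induction k with
  | zero => exact subset_rfl
  | succ k ih => exact fun s hs => ih hs.1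

theorem chain_min_unique {M : Type*} [LinearOrder M] {m n : ℕ} (R : Set (Fin (m + n) → M)) (k : ℕ)
    (e : Fin m → M) (s t : Fin n → M) (hs : Fin.append e s ∈ chain R k \ chain R (k + 1))
    (ht : Fin.append e t ∈ chain R k \ chain R (k + 1)) : s = t := by
  rcases lt_trichotomy (toLex s) (toLex t) with h | h | h
  · exact absurd ⟨ht.1, (append_mem_bad _ _ _).2 ⟨s, hs.1, h⟩⟩ ht.2
  · exact toLex.injective h
  · exact absurd ⟨hs.1, (append_mem_bad _ _ _).2 ⟨t, ht.1, h⟩⟩ hs.2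

theorem chain_cover {M : Type*} [LinearOrder M] {m n d : ℕ} (R : Set (Fin (m + n) → M))
    (e : Fin m → M) (hf : {s : Fin n → M | Fin.append e s ∈ R}.Finite)
    (hc : {s : Fin n → M | Fin.append e s ∈ R}.ncard ≤ d) (s : Fin n → M)
    (hs : Fin.append e s ∈ R) : ∃ k : Fin d, Fin.append e s ∈ chain R k \ chain R (k + 1) := by
  by_contra! hcon
  have key : ∀ k ≤ d, Fin.append e s ∈ chain R k := by
    intro k
    induction k with
    | zero => exact fun _ => hs
    | succ k ih =>
      intro hk
      by_contra h
      exact hcon ⟨k, hk⟩ ⟨ih (by omega), h⟩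
  obtain ⟨h1, h2⟩ := chain_card R e hf hc d
  rw [Nat.sub_self, Nat.le_zero, Set.ncard_eq_zero h1] at h2
  exact (Set.eq_empty_iff_forall_notMem.1 h2 s) (key d le_rfl)

theorem main_aux (L : Language) (M : Type*) [L.Structure M] [LinearOrder M] (D : Set M)
    (hle : Set.Definable (Set.univ : Set M) L {v : Fin 2 → M | v 0 ≤ v 1})
    (hD2 : ∃ x ∈ D, ∃ y ∈ D, x ≠ y) {n : ℕ} (S : Set (Fin n → M))
    (hS : AlmostInternal L M D S) : Internal L M D S := by
  obtain ⟨x, hx, y, hy, hxy⟩ := hD2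
  obtain ⟨m, d, E, R, hE, hR, hED, hRE, hcard, rfl⟩ := hS
  set c : Fin d → Fin d → M := fun k i => if i = k then y else x with hc
  have hcD : ∀ k i, c k i ∈ D := by
    intro k i
    simp only [hc]
    split_ifs <;> assumption
  have hcinj : ∀ k l, c k = c l → k = l := by
    intro k l h
    have := congrFun h k
    simp only [hc, if_true] at this
    by_contra hne
    rw [if_neg hne] at this
    exact hxy this.symm
  let G : Set (Fin (m + d + n) → M) := ⋃ k : Fin d,
    ((fun v => v ∘ Fin.append (fun i => Fin.castAdd n (Fin.castAdd d i)) (Fin.natAdd (m + d))) ⁻¹'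
      (chain R k \ chain R (k + 1))) ∩
    ⋂ i : Fin d, {v | v (Fin.castAdd n (Fin.natAdd m i)) = c k i}
  have hG : Set.Definable (Set.univ : Set M) L G :=
    Set.definable_iUnion_of_finite fun k =>
      (((chain_def hle hR k).sdiff (chain_def hle hR (k + 1))).preimage_comp _).inter
        (Set.definable_iInter_of_finite fun i => def_const _ _)
  have hmem : ∀ (e : Fin (m + d) → M) (s : Fin n → M), Fin.append e s ∈ G ↔
      ∃ k : Fin d, Fin.append (fun i => e (Fin.castAdd d i)) s ∈ chain R k \ chain R (k + 1) ∧
        (fun i => e (Fin.natAdd m i)) = c k := by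
    intro e s
    have : Fin.append e s ∘
        Fin.append (fun i => Fin.castAdd n (Fin.castAdd d i)) (Fin.natAdd (m + d)) =
        Fin.append (fun i => e (Fin.castAdd d i)) s := by
      ext i
      refine Fin.addCases (fun i => ?_) (fun i => ?_) i <;> simp
    simp only [G, Set.mem_iUnion, Set.mem_inter_iff, Set.mem_preimage, this, Set.mem_iInter,
      Set.mem_ofPred_eq, Fin.append_left, funext_iff]
  have hsplit : ∀ v : Fin (m + d + n) → M, Fin.append (fun i => v (Fin.castAdd n i))
      (fun i => v (Fin.natAdd (m + d) i)) = v := fun v => by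
    ext i
    refine Fin.addCases (fun i => ?_) (fun i => ?_) i <;> simp
  refine ⟨m + d, (fun v => v ∘ Fin.castAdd n) '' G, G, hG.image_comp _, hG, ?_, ?_, ?_, ?_⟩
  · rintro _ ⟨v, hv, rfl⟩ i
    rw [← hsplit v, hmem] at hv
    obtain ⟨k, hk, hk'⟩ := hv
    refine Fin.addCases (fun i => ?_) (fun i => ?_) i
    · have := (hRE _ (chain_anti R k hk.1)).1
      simp only [Fin.append_left] at this
      exact hED _ this i
    · have := congrFun hk' i
      change v (Fin.castAdd n (Fin.natAdd m i)) ∈ D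
      rw [this]
      exact hcD k i
  · exact fun v hv => ⟨v, hv, rfl⟩
  · rintro _ ⟨v, hv, rfl⟩
    refine ⟨fun i => v (Fin.natAdd (m + d) i), ?_, ?_⟩
    · have := hsplit v
      simp only [Function.comp_def]
      rw [this]
      exact hv
    · intro t ht
      rw [← hsplit v, hmem] at hv
      rw [hmem] at ht
      obtain ⟨k, hk, hk'⟩ := hv
      obtain ⟨l, hl, hl'⟩ := ht
      have : k = l := hcinj _ _ (hk'.symm.trans hl')
      subst this
      exact chain_min_unique R k _ _ _ hl hk
  · ext s
    simp only [Set.mem_ofPred_eq]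
    constructor
    · rintro ⟨e, he, hes⟩
      obtain ⟨k, hk⟩ := chain_cover R e (hcard e he).1 (hcard e he).2 s hes
      have : Fin.append (Fin.append e (c k)) s ∈ G := by
        rw [hmem]
        exact ⟨k, by simpa using hk, by simp⟩
      exact ⟨Fin.append e (c k), ⟨_, this, by ext i; simp⟩, this⟩
    · rintro ⟨e, -, hes⟩
      rw [hmem] at hes
      obtain ⟨k, hk, -⟩ := hes
      have h := chain_anti R k hk.1
      refine ⟨_, ?_, h⟩
      have := (hRE _ h).1
      simpa only [Fin.append_left] using this

end AIproof

/-- If `M` carries a definable total (linear) ordering, then every definable set that is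
almost internal to a `0`-definable set `D` with at least two elements is internal to `D`. -/
theorem almostInternal_internal_of_definable_linear_order
    (L : Language) (M : Type*) [L.Structure M] (D : Set M)
    (hD : Set.Definable₁ (∅ : Set M) L D) (hD2 : ∃ x ∈ D, ∃ y ∈ D, x ≠ y)
    (O : Set (Fin 2 → M))
    (hOdef : Set.Definable (Set.univ : Set M) L O)
    (hrefl : ∀ a : M, ![a, a] ∈ O)
    (hantisymm : ∀ a b : M, ![a, b] ∈ O → ![b, a] ∈ O → a = b)
    (htrans : ∀ a b c : M, ![a, b] ∈ O → ![b, c] ∈ O → ![a, c] ∈ O)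
    (htotal : ∀ a b : M, ![a, b] ∈ O ∨ ![b, a] ∈ O)
    {n : ℕ} (S : Set (Fin n → M))
    (hSdef : Set.Definable (Set.univ : Set M) L S)
    (hS : AlmostInternal L M D S) :
    Internal L M D S := by
  classical
  letI : LinearOrder M :=
    { le := fun a b => ![a, b] ∈ O
      le_refl := hrefl
      le_trans := htrans
      le_antisymm := hantisymm
      le_total := htotal
      toDecidableLE := Classical.decRel _ }
  refine AIproof.main_aux L M D ?_ hD2 S hS
  convert hOdef using 1
  ext v
  have : ![v 0, v 1] = v := by
    ext i
    fin_cases i <;> rfl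
  change ![v 0, v 1] ∈ O ↔ v ∈ O
  rw [this]
end

section
/- Let (K, k) be a pair of algebraically closed fields, viewed as a structure for the language of rings augmented by a unary predicate U interpreted as k. Let S ⊆ K be definable in (K, k), and suppose S is contained in a finite union of Φ₂-sets of (K, k). Then S is almost internal to k: there exist m, d ∈ ℕ and a definable relation R ⊆ k^m × K such that the section R(u) has at most d elements for every u ∈ k^m and ⋃_{u ∈ k^m} R(u) = S. -/
open FirstOrder

/-- The language with a single unary relation symbol `U` (and no other symbols). -/
def unaryLang : Language :=
  ⟨fun _ => Empty, fun n => match n with | 1 => PUnit | _ => Empty⟩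

/-- The language of rings augmented by a unary relation symbol `U`. -/
def LU : Language := Language.ring.sum unaryLang

/-- The `LU`-structure on a field `K` with the unary predicate `U` interpreted as the
subfield `k`. -/
noncomputable def pairStructure (K : Type*) [Field K] (k : Subfield K) :
    LU.Structure K :=
  letI : Language.ring.Structure K := (FirstOrder.Ring.compatibleRingOfRing K).toStructure
  letI : unaryLang.Structure K :=
    { funMap := fun {n} f _ => f.elim
      RelMap := fun {n} r x =>
        match n, r with
        | 1, _ => x 0 ∈ k
        | 0, r => r.elim
        | (_ + 2), r => r.elim }
  (inferInstance : (Language.ring.sum unaryLang).Structure K)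

/-- Definability with parameters in the pair `(K, k)`, viewed as an `LU`-structure. -/
def DefinableInPair (K : Type*) [Field K] (k : Subfield K) {α : Type*}
    (s : Set (α → K)) : Prop :=
  letI := pairStructure K k
  Set.Definable (Set.univ : Set K) LU s

def TermFun (K : Type*) [Field K] (k : Subfield K) {α : Type*} (f : (α → K) → K) : Prop :=
  letI := pairStructure K k
  ∃ t : (LU[[(Set.univ : Set K)]]).Term α, ∀ x, t.realize x = f x

section helpers

variable {K : Type*} [Field K] (k : Subfield K) {α : Type*}

theorem TermFun.var (i : α) : TermFun K k (fun x : α → K => x i) := by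
  letI := pairStructure K k
  exact ⟨Language.Term.var i, fun x => rfl⟩

theorem TermFun.const (c : K) : TermFun K k (fun _ : α → K => c) := by
  letI := pairStructure K k
  exact ⟨Language.Constants.term (LU.con (⟨c, trivial⟩ : (Set.univ : Set K))), fun x => by simp⟩

theorem TermFun.add {f g : (α → K) → K} (hf : TermFun K k f) (hg : TermFun K k g) :
    TermFun K k (fun x => f x + g x) := by
  letI := pairStructure K k
  obtain ⟨s, hs⟩ := hf
  obtain ⟨t, ht⟩ := hg
  let F : (LU[[(Set.univ : Set K)]]).Functions 2 :=
    Sum.inl (Sum.inl FirstOrder.ringFunc.add)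
  refine ⟨Language.Functions.apply₂ F s t, fun x => ?_⟩
  rw [Language.Term.realize_functions_apply₂, hs, ht]
  rfl

theorem TermFun.mul {f g : (α → K) → K} (hf : TermFun K k f) (hg : TermFun K k g) :
    TermFun K k (fun x => f x * g x) := by
  letI := pairStructure K k
  obtain ⟨s, hs⟩ := hf
  obtain ⟨t, ht⟩ := hg
  let F : (LU[[(Set.univ : Set K)]]).Functions 2 :=
    Sum.inl (Sum.inl FirstOrder.ringFunc.mul)
  refine ⟨Language.Functions.apply₂ F s t, fun x => ?_⟩
  rw [Language.Term.realize_functions_apply₂, hs, ht]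
  rfl

theorem TermFun.definable {f : (α → K) → K} (hf : TermFun K k f) :
    DefinableInPair K k {x | f x = 0} := by
  obtain ⟨t, ht⟩ := hf
  obtain ⟨s, hs⟩ := TermFun.const k (α := α) (0 : K)
  letI := pairStructure K k
  refine ⟨t.equal s, ?_⟩
  ext x
  simp only [Set.mem_setOf_eq]
  rw [Language.Formula.realize_equal, ht, hs]

theorem definable_mem (i : α) : DefinableInPair K k {x : α → K | x i ∈ k} := by
  letI := pairStructure K k
  let r : (LU[[(Set.univ : Set K)]]).Relations 1 :=
    Sum.inl (Sum.inr PUnit.unit)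
  refine ⟨Language.Relations.formula₁ r (Language.Term.var i), ?_⟩
  ext x
  simp only [Set.mem_setOf_eq]
  rw [Language.Formula.realize_rel₁]
  rfl

theorem TermFun.poly {m n : ℕ} (P : MvPolynomial (Fin m ⊕ Fin n ⊕ Unit) ℤ)
    (f : Fin m → α) (a : Fin n → K) {g : (α → K) → K} (hg : TermFun K k g) :
    TermFun K k (fun x => (polyEvalZ P (fun i => x (f i)) a).eval (g x)) := by
  induction P using MvPolynomial.induction_on with
  | C c =>
    have := TermFun.const k (α := α) (c : K)
    simpa [polyEvalZ] using this
  | add p q hp hq =>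
    have := TermFun.add k hp hq
    simpa [polyEvalZ] using this
  | mul_X p i hp =>
    rcases i with i | i | i
    · have := TermFun.mul k hp (TermFun.var k (f i))
      simpa [polyEvalZ] using this
    · have := TermFun.mul k hp (TermFun.const k (a i))
      simpa [polyEvalZ] using this
    · have := TermFun.mul k hp hg
      simpa [polyEvalZ] using this

theorem exists_natDegree_bound {m n : ℕ} (P : MvPolynomial (Fin m ⊕ Fin n ⊕ Unit) ℤ) :
    ∃ D : ℕ, ∀ (u : Fin m → K) (a : Fin n → K), (polyEvalZ P u a).natDegree ≤ D := by
  induction P using MvPolynomial.induction_on with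
  | C c => exact ⟨0, fun u a => by simp [polyEvalZ]⟩
  | add p q hp hq =>
    obtain ⟨D, hD⟩ := hp
    obtain ⟨E, hE⟩ := hq
    refine ⟨max D E, fun u a => ?_⟩
    have : polyEvalZ (p + q) u a = polyEvalZ p u a + polyEvalZ q u a := by simp [polyEvalZ]
    rw [this]
    exact (Polynomial.natDegree_add_le _ _).trans (max_le_max (hD u a) (hE u a))
  | mul_X p i hp =>
    obtain ⟨D, hD⟩ := hp
    refine ⟨D + 1, fun u a => ?_⟩
    have : polyEvalZ (p * MvPolynomial.X i) u a = polyEvalZ p u a *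
      (Sum.elim (fun i => Polynomial.C (u i))
        (Sum.elim (fun j => Polynomial.C (a j)) (fun _ => Polynomial.X)) i) := by
      simp [polyEvalZ]
    rw [this]
    refine Polynomial.natDegree_mul_le.trans (add_le_add (hD u a) ?_)
    rcases i with i | i | i <;> simp

theorem definable_phi [Infinite K] {m n : ℕ} (P : MvPolynomial (Fin m ⊕ Fin n ⊕ Unit) ℤ)
    (f : Fin m → α) (a : Fin n → K) (i : α) :
    DefinableInPair K k {x : α → K | polyEvalZ P (fun i => x (f i)) a ≠ 0 ∧
      (polyEvalZ P (fun i => x (f i)) a).eval (x i) = 0} := by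
  obtain ⟨D, hD⟩ := exists_natDegree_bound (K := K) P
  obtain ⟨T, hT⟩ := Infinite.exists_subset_card_eq K (D + 1)
  have h1 := (TermFun.poly k P f a (TermFun.var k i)).definable
  have h2 := fun c => (TermFun.poly k P f a (TermFun.const k c)).definable
  letI := pairStructure K k
  have h3 : DefinableInPair K k
      (⋃ c ∈ T, {x : α → K | (polyEvalZ P (fun i => x (f i)) a).eval c = 0}ᶜ) :=
    Set.definable_biUnion_finset (fun c => (h2 c).compl) T
  have h4 : DefinableInPair K k (_ ∩ _) := Set.Definable.inter h3 h1
  convert h4 using 1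
  ext x
  simp only [Set.mem_setOf_eq, Set.mem_inter_iff, Set.mem_iUnion, Set.mem_compl_iff]
  refine and_congr_left fun _ => ⟨fun h => ?_, ?_⟩
  · by_contra! hc
    refine h (Polynomial.eq_zero_of_natDegree_lt_card_of_eval_eq_zero' _ T hc ?_)
    have := hD (fun i => x (f i)) a
    omega
  · rintro ⟨c, _, hc⟩ h
    exact hc (by simp [h])

end helpers

/-- If `(K, k)` is a pair of algebraically closed fields and `S ⊆ K` is definable in
`(K, k)` and contained in a finite union of Φ₂-sets, then `S` is almost internal to `k`:
there are `m`, `d` and a definable relation `R ⊆ k^m × K` all of whose sections `R(u)`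
have at most `d` elements, with `⋃_{u ∈ k^m} R(u) = S`. -/
theorem almostInternal_of_subset_finite_union_phi2
    {K : Type*} [Field K] [IsAlgClosed K] (k : Subfield K) [IsAlgClosed k] (hk : k ≠ ⊤)
    (S : Set K) (hSdef : DefinableInPair K k {x : Fin 1 → K | x 0 ∈ S})
    (hΦ : ∃ (N : ℕ) (m n : Fin N → ℕ)
        (P : (j : Fin N) → MvPolynomial (Fin (m j) ⊕ Fin (n j) ⊕ Unit) ℤ)
        (a : (j : Fin N) → Fin (n j) → K),
      S ⊆ {b : K | ∃ (j : Fin N) (u : Fin (m j) → K), (∀ i, u i ∈ k) ∧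
        polyEvalZ (P j) u (a j) ≠ 0 ∧ (polyEvalZ (P j) u (a j)).eval b = 0}) :
    ∃ (m d : ℕ) (R : Set (Fin (m + 1) → K)),
      DefinableInPair K k R ∧
      (∀ x ∈ R, ∀ i : Fin m, x (Fin.castAdd 1 i) ∈ k) ∧
      (∀ u : Fin m → K, (∀ i, u i ∈ k) →
        {b : K | Fin.append u ![b] ∈ R}.Finite ∧
        {b : K | Fin.append u ![b] ∈ R}.ncard ≤ d) ∧
      S = {b : K | ∃ u : Fin m → K, (∀ i, u i ∈ k) ∧ Fin.append u ![b] ∈ R} := by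
  classical
  obtain ⟨N, m, n, P, a, hS⟩ := hΦ
  haveI : Infinite K := IsAlgClosed.instInfinite
  choose D hD using fun j => exists_natDegree_bound (K := K) (P j)
  let M := ∑ j, m j
  let e : (Σ j, Fin (m j)) ≃ Fin M := finSigmaFinEquiv
  let f : (j : Fin N) → Fin (m j) → Fin (M + 1) := fun j i => Fin.castAdd 1 (e ⟨j, i⟩)
  let l : Fin (M + 1) := Fin.natAdd M 0
  let A : Fin N → Set (Fin (M + 1) → K) := fun j =>
    {x | polyEvalZ (P j) (fun i => x (f j i)) (a j) ≠ 0 ∧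
      (polyEvalZ (P j) (fun i => x (f j i)) (a j)).eval (x l) = 0}
  let B : Set (Fin (M + 1) → K) := {x | x l ∈ S}
  let C : Fin M → Set (Fin (M + 1) → K) := fun i => {x | x (Fin.castAdd 1 i) ∈ k}
  have hA : ∀ j, DefinableInPair K k (A j) := fun j => definable_phi k (P j) (f j) (a j) l
  have hC : ∀ i, DefinableInPair K k (C i) := fun i => definable_mem k _
  have hB : DefinableInPair K k B := by
    letI := pairStructure K k
    exact Set.Definable.preimage_comp (fun _ : Fin 1 => l) hSdef
  have happ : ∀ (u : Fin M → K) (b : K) (j : Fin N), Fin.append u ![b] ∈ A j ↔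
      polyEvalZ (P j) (fun i => u (e ⟨j, i⟩)) (a j) ≠ 0 ∧
      (polyEvalZ (P j) (fun i => u (e ⟨j, i⟩)) (a j)).eval b = 0 := by
    intro u b j
    simp only [A, f, l, Set.mem_setOf_eq, Fin.append_left, Fin.append_right]
    rfl
  have hRdef : DefinableInPair K k
      ((B ∩ ⋂ i ∈ (Finset.univ : Finset (Fin M)), C i) ∩
        ⋃ j ∈ (Finset.univ : Finset (Fin N)), A j) := by
    letI := pairStructure K k
    exact Set.Definable.inter (Set.Definable.inter hB (Set.definable_biInter_finset hC _))
      (Set.definable_biUnion_finset hA _)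
  refine ⟨M, ∑ j, D j, _, hRdef, ?_, ?_, ?_⟩
  · rintro x ⟨⟨_, hx⟩, _⟩ i
    simp only [Set.mem_iInter] at hx
    exact hx i (Finset.mem_univ i)
  · intro u hu
    let F : Finset K := Finset.univ.biUnion fun j =>
      (polyEvalZ (P j) (fun i => u (e ⟨j, i⟩)) (a j)).roots.toFinset
    have hsub : {b : K | Fin.append u ![b] ∈ ((B ∩ ⋂ i ∈ (Finset.univ : Finset (Fin M)), C i) ∩
        ⋃ j ∈ (Finset.univ : Finset (Fin N)), A j)} ⊆ (F : Set K) := by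
      rintro b ⟨_, hb⟩
      simp only [Set.mem_iUnion] at hb
      obtain ⟨j, _, hb⟩ := hb
      rw [happ] at hb
      simp only [F, Finset.coe_biUnion, Set.mem_iUnion]
      refine ⟨j, by simp, ?_⟩
      simpa using hb
    refine ⟨F.finite_toSet.subset hsub, ?_⟩
    refine (Set.ncard_le_ncard hsub F.finite_toSet).trans ?_
    rw [Set.ncard_coe_finset]
    refine Finset.card_biUnion_le.trans (Finset.sum_le_sum fun j _ => ?_)
    exact (Multiset.toFinset_card_le _).trans ((Polynomial.card_roots' _).trans (hD j _ _))
  · have hBm : ∀ (u : Fin M → K) (b : K), Fin.append u ![b] ∈ B ↔ b ∈ S := by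
      intro u b
      simp only [B, l, Set.mem_setOf_eq, Fin.append_right]
      rfl
    ext b
    constructor
    · intro hb
      obtain ⟨j, u, hu, h1, h2⟩ := hS hb
      let v : (j : Fin N) → Fin (m j) → K := Function.update (fun _ _ => 0) j u
      have hv : ∀ j' i, v j' i ∈ k := by
        intro j' i
        by_cases h : j' = j
        · subst h
          simpa [v] using hu i
        · simp [v, Function.update_of_ne h, k.zero_mem]
      have hvj : v j = u := by simp [v]
      refine ⟨fun i => v (e.symm i).1 (e.symm i).2, fun i => hv _ _,
        ⟨(hBm _ _).2 hb, ?_⟩, ?_⟩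
      · simp only [Set.mem_iInter]
        intro i _
        simp only [C, Set.mem_setOf_eq, Fin.append_left]
        exact hv _ _
      · simp only [Set.mem_iUnion]
        refine ⟨j, Finset.mem_univ j, ?_⟩
        rw [happ]
        have : (fun i => v (e.symm (e ⟨j, i⟩)).1 (e.symm (e ⟨j, i⟩)).2) = u := by
          funext i
          have h3 : e.symm (e ⟨j, i⟩) = ⟨j, i⟩ := e.symm_apply_apply _
          have h4 : ∀ p : (Σ j, Fin (m j)), p = ⟨j, i⟩ → v p.1 p.2 = u i := by
            rintro p rfl
            exact congrFun hvj i
          exact h4 _ h3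
        rw [this]
        exact ⟨h1, h2⟩
    · rintro ⟨u, _, ⟨hb, _⟩, _⟩
      exact (hBm u b).1 hb
end

section
/- Let k be a field of characteristic 0, K a field extension of k, and t ∈ K transcendental over k. Suppose b₁,…,b_m ∈ K satisfy b_i² = t + i for i = 1,…,m (where i denotes the image of the integer i in K). Then the degree [k(t)(b₁,…,b_m) : k(t)] equals 2^m. In particular, the fields k(t)(b₁) ⊂ k(t)(b₁,b₂) ⊂ k(t)(b₁,b₂,b₃) ⊂ ⋯ form a strictly increasing chain. -/
open Polynomial in
theorem aux_mem {L K : Type*} [Field L] [Field K] [Algebra L K] (c : K) (a : L)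
    (hc : c ^ 2 = algebraMap L K a) (y : K) (hy : y ∈ IntermediateField.adjoin L {c}) :
    ∃ u v : L, y = algebraMap L K u + algebraMap L K v * c := by
  have hint : IsIntegral L c := by
    refine IsIntegral.of_pow (n := 2) (by norm_num) ?_
    rw [hc]; exact isIntegral_algebraMap
  rw [← IntermediateField.mem_toSubalgebra,
    IntermediateField.adjoin_simple_toSubalgebra_of_isAlgebraic hint.isAlgebraic] at hy
  induction hy using Algebra.adjoin_induction with
  | mem x hx => exact ⟨0, 1, by simp at hx; simp [hx]⟩
  | algebraMap r => exact ⟨r, 0, by simp⟩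
  | add x y _ _ hx hy =>
    obtain ⟨u, v, rfl⟩ := hx
    obtain ⟨u', v', rfl⟩ := hy
    exact ⟨u + u', v + v', by simp only [map_add]; ring⟩
  | mul x y _ _ hx hy =>
    obtain ⟨u, v, rfl⟩ := hx
    obtain ⟨u', v', rfl⟩ := hy
    refine ⟨u * u' + v * v' * a, u * v' + v * u', ?_⟩
    simp only [map_add, map_mul, ← hc]; ring

theorem aux_insert {F K ι : Type*} [Field F] [Field K] [Algebra F K] [DecidableEq ι]
    (b : ι → K) (i : ι) (s : Finset ι) :
    IntermediateField.adjoin F (b '' ((insert i s : Finset ι) : Set ι)) =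
      (IntermediateField.adjoin (IntermediateField.adjoin F (b '' (s : Set ι)))
        {b i}).restrictScalars F := by
  rw [IntermediateField.adjoin_adjoin_left, Finset.coe_insert, Set.image_insert_eq,
    Set.insert_eq, Set.union_comm]

theorem aux_kummer {F K ι : Type*} [Field F] [Field K] [Algebra F K] [DecidableEq ι]
    (h2 : (2 : K) ≠ 0) (b : ι → K) (a : ι → F) (hb : ∀ i, b i ^ 2 = algebraMap F K (a i))
    (s : Finset ι) :
    ∀ (x : F) (y : K), y ∈ IntermediateField.adjoin F (b '' (s : Set ι)) →
      y ^ 2 = algebraMap F K x → ∃ T ⊆ s, IsSquare (x * ∏ i ∈ T, a i) := by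
  induction s using Finset.induction_on with
  | empty =>
    intro x y hy hxy
    simp only [Finset.coe_empty, Set.image_empty, IntermediateField.adjoin_empty] at hy
    obtain ⟨z, rfl⟩ := IntermediateField.mem_bot.1 hy
    refine ⟨∅, le_rfl, z, ?_⟩
    rw [← map_pow] at hxy
    have := (algebraMap F K).injective hxy
    simp [← this, sq]
  | insert i s hi ih =>
    intro x y hy hxy
    rw [aux_insert, IntermediateField.mem_restrictScalars] at hy
    set L := IntermediateField.adjoin F (b '' (s : Set ι)) with hL
    obtain ⟨u, v, huv⟩ := aux_mem (L := L) (b i) (algebraMap F L (a i))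
      (by rw [hb]; rfl) y hy
    have huv' : y = (u : K) + v * b i := huv
    by_cases hbL : b i ∈ L
    · obtain ⟨T, hT, h⟩ := ih x y (by rw [huv']; exact add_mem u.2 (mul_mem v.2 hbL)) hxy
      exact ⟨T, hT.trans (Finset.subset_insert _ _), h⟩
    · have h0 : (u : K) * v = 0 := by
        by_contra hne
        apply hbL
        have : b i = (algebraMap F K x - u ^ 2 - v ^ 2 * algebraMap F K (a i)) / (2 * (u * v)) := by
          rw [eq_div_iff (mul_ne_zero h2 hne), ← hxy, ← hb, huv']; ring
        rw [this]
        refine div_mem (sub_mem (sub_mem (L.algebraMap_mem x) (pow_mem u.2 2))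
          (mul_mem (pow_mem v.2 2) (L.algebraMap_mem _))) (mul_mem ?_ (mul_mem u.2 v.2))
        exact ofNat_mem L 2
      rcases mul_eq_zero.1 h0 with h | h
      · obtain ⟨T, hT, hs⟩ := ih (x * a i) (v * a i • (1 : K))
          (mul_mem v.2 (L.smul_mem (one_mem L))) (by
            rw [map_mul, ← hxy, huv', h, Algebra.smul_def, ← hb]; ring)
        refine ⟨insert i T, Finset.insert_subset_insert _ hT, ?_⟩
        rw [Finset.prod_insert (fun h => hi (hT h)), ← mul_assoc]
        exact hs
      · obtain ⟨T, hT, hs⟩ := ih x y (by rw [huv', h]; simp) hxy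
        exact ⟨T, hT.trans (Finset.subset_insert _ _), hs⟩

theorem aux_not_mem {F K ι : Type*} [Field F] [Field K] [Algebra F K] [DecidableEq ι]
    (h2 : (2 : K) ≠ 0) (b : ι → K) (a : ι → F) (hb : ∀ i, b i ^ 2 = algebraMap F K (a i))
    (hns : ∀ T : Finset ι, T.Nonempty → ¬ IsSquare (∏ i ∈ T, a i))
    (s : Finset ι) (i : ι) (hi : i ∉ s) :
    b i ∉ IntermediateField.adjoin F (b '' (s : Set ι)) := by
  intro h
  obtain ⟨T, hT, hs⟩ := aux_kummer h2 b a hb s (a i) (b i) h (hb i)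
  rw [← Finset.prod_insert (fun h => hi (hT h))] at hs
  exact hns _ (Finset.insert_nonempty _ _) hs

open Polynomial in
theorem aux_two {L K : Type*} [Field L] [Field K] [Algebra L K] (c : K) (a : L)
    (hc : c ^ 2 = algebraMap L K a) (hn : ∀ u : L, algebraMap L K u ≠ c) :
    Module.finrank L (IntermediateField.adjoin L {c}) = 2 := by
  have hint : IsIntegral L c := by
    refine IsIntegral.of_pow (n := 2) (by norm_num) ?_
    rw [hc]; exact isIntegral_algebraMap
  rw [IntermediateField.adjoin.finrank hint]
  have hirr : Irreducible (X ^ 2 - C a : L[X]) := by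
    refine X_pow_sub_C_irreducible_of_prime Nat.prime_two ?_
    intro u hu
    have : (algebraMap L K u) ^ 2 = c ^ 2 := by rw [hc, ← hu, map_pow]
    rcases sq_eq_sq_iff_eq_or_eq_neg.1 this with h | h
    · exact hn u h
    · exact hn (-u) (by rw [map_neg, h, neg_neg])
  rw [← minpoly.eq_of_irreducible_of_monic hirr (by simp [hc])
    (monic_X_pow_sub_C a two_ne_zero)]
  exact natDegree_X_pow_sub_C

theorem aux_finrank {F K ι : Type*} [Field F] [Field K] [Algebra F K] [DecidableEq ι]
    (h2 : (2 : K) ≠ 0) (b : ι → K) (a : ι → F) (hb : ∀ i, b i ^ 2 = algebraMap F K (a i))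
    (hns : ∀ T : Finset ι, T.Nonempty → ¬ IsSquare (∏ i ∈ T, a i))
    (s : Finset ι) :
    Module.finrank F (IntermediateField.adjoin F (b '' (s : Set ι))) = 2 ^ s.card := by
  induction s using Finset.induction_on with
  | empty => simp
  | insert i s hi ih =>
    have hnm := aux_not_mem h2 b a hb hns s i hi
    rw [aux_insert, Finset.card_insert_of_notMem hi, pow_succ, ← ih]
    set L := IntermediateField.adjoin F (b '' (s : Set ι)) with hL
    have := aux_two (L := L) (b i) (algebraMap F L (a i)) (by rw [hb]; rfl)
      (fun u hu => hnm (by rw [← hu]; exact u.2))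
    rw [← this]
    exact (Module.finrank_mul_finrank F L (IntermediateField.adjoin L {b i})).symm

open Polynomial in
theorem aux_nonsq {k : Type*} [Field k] [CharZero k] (T : Finset ℕ) (hT : T.Nonempty)
    (p q : k[X]) (hq : q ≠ 0) : q ^ 2 * ∏ i ∈ T, (X + C (((i + 1 : ℕ) : k))) ≠ p ^ 2 := by
  intro h
  obtain ⟨i, hi⟩ := hT
  have hne : ∀ j : ℕ, (X + C ((j + 1 : ℕ) : k)) ≠ 0 := fun j => X_add_C_ne_zero _
  have hp0 : (∏ j ∈ T, (X + C (((j + 1 : ℕ) : k)))) ≠ 0 := Finset.prod_ne_zero_iff.2 fun j _ => hne j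
  have hE0 : (∏ j ∈ T.erase i, (X + C (((j + 1 : ℕ) : k)))) ≠ 0 :=
    Finset.prod_ne_zero_iff.2 fun j _ => hne j
  have hp : p ≠ 0 := by
    rintro rfl
    rw [zero_pow two_ne_zero] at h
    exact mul_ne_zero (pow_ne_zero 2 hq) hp0 h
  have hm := congrArg (rootMultiplicity (-((i + 1 : ℕ) : k))) h
  have e1 : rootMultiplicity (-((i + 1 : ℕ) : k)) (∏ j ∈ T.erase i, (X + C (((j + 1 : ℕ) : k)))) = 0 := by
    apply rootMultiplicity_eq_zero
    rw [IsRoot, eval_prod, Finset.prod_eq_zero_iff]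
    rintro ⟨j, hj, hz⟩
    simp only [eval_add, eval_X, eval_C] at hz
    have : ((j + 1 : ℕ) : k) = ((i + 1 : ℕ) : k) := by linear_combination hz
    have := Nat.cast_injective this
    exact (Finset.mem_erase.1 hj).1 (by omega)
  have e2 : rootMultiplicity (-((i + 1 : ℕ) : k)) (X + C (((i + 1 : ℕ) : k))) = 1 := by
    have := rootMultiplicity_X_sub_C_self (x := -((i + 1 : ℕ) : k))
    rwa [C_neg, sub_neg_eq_add] at this
  rw [← Finset.mul_prod_erase T _ hi, sq, sq, 
    rootMultiplicity_mul (mul_ne_zero (mul_ne_zero hq hq) (mul_ne_zero (hne i) hE0)),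
    rootMultiplicity_mul (mul_ne_zero hq hq), rootMultiplicity_mul (mul_ne_zero hp hp),
    rootMultiplicity_mul (mul_ne_zero (hne i) hE0), e1, e2] at hm
  omega

open Polynomial in
theorem aux_nonsq' {k K : Type*} [Field k] [Field K] [Algebra k K] [CharZero k]
    (t : K) (ht : Transcendental k t) (m : ℕ) (a : Fin m → IntermediateField.adjoin k {t})
    (ha : ∀ i, (a i : K) = t + (((i : ℕ) + 1 : ℕ) : K)) (T : Finset (Fin m)) (hT : T.Nonempty) :
    ¬ IsSquare (∏ i ∈ T, a i) := by
  rintro ⟨z, hz⟩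
  obtain ⟨p, q, hpq⟩ := (IntermediateField.mem_adjoin_simple_iff k (z : K)).1 z.2
  have hz' : ∏ i ∈ T, (a i : K) = z * z := by
    have := congrArg (algebraMap (IntermediateField.adjoin k {t}) K) hz
    rw [map_prod, map_mul] at this
    exact this
  have hinj := transcendental_iff_injective.1 ht
  have key : ∏ i ∈ T.map Fin.valEmbedding, (t + (((i : ℕ) + 1 : ℕ) : K)) =
      aeval t (∏ i ∈ T.map Fin.valEmbedding, (X + C (((i + 1 : ℕ) : k)))) := by
    rw [map_prod]; simp
  have hz2 : ∏ i ∈ T.map Fin.valEmbedding, (t + (((i : ℕ) + 1 : ℕ) : K)) = z * z := by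
    rw [← hz', Finset.prod_map]
    exact Finset.prod_congr rfl fun i _ => (ha i).symm
  have hq : q ≠ 0 := by
    rintro rfl
    rw [map_zero, div_zero] at hpq
    rw [hpq, mul_zero, key, ← map_zero (aeval (R := k) t)] at hz2
    exact Finset.prod_ne_zero_iff.2 (fun j _ => X_add_C_ne_zero _) (hinj hz2)
  have hq' : aeval t q ≠ 0 := fun h => hq (hinj (by rw [h, map_zero]))
  refine aux_nonsq (T.map Fin.valEmbedding) (by simpa using hT) p q hq (hinj ?_)
  rw [map_mul, ← key, hz2, hpq, map_pow, map_pow]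
  field_simp

/-- Let `k` have characteristic `0`, `K` a field extension of `k`, `t ∈ K` transcendental
over `k`, and `b₁,…,b_m ∈ K` with `b_i² = t + i` for `i = 1,…,m`. Then
`[k(t)(b₁,…,b_m) : k(t)] = 2^m`; in particular the fields `k(t)(b₁,…,b_j)` form a strictly
increasing chain in `j`. -/
theorem degree_adjoin_sqrts {k K : Type*} [Field k] [Field K] [Algebra k K] [CharZero k]
    (t : K) (ht : Transcendental k t) (m : ℕ) (b : Fin m → K)
    (hb : ∀ i : Fin m, (b i) ^ 2 = t + (((i : ℕ) + 1 : ℕ) : K)) :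
    Module.finrank (IntermediateField.adjoin k {t})
      (IntermediateField.adjoin (IntermediateField.adjoin k {t}) (Set.range b)) = 2 ^ m ∧
    (∀ j₁ j₂ : ℕ, j₁ < j₂ → j₂ ≤ m →
      IntermediateField.adjoin k ({t} ∪ b '' {i : Fin m | (i : ℕ) < j₁}) <
      IntermediateField.adjoin k ({t} ∪ b '' {i : Fin m | (i : ℕ) < j₂})) := by
  have : CharZero K := charZero_of_injective_algebraMap (algebraMap k K).injective
  have h2 : (2 : K) ≠ 0 := two_ne_zero
  let a : Fin m → IntermediateField.adjoin k {t} := fun i =>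
    ⟨t + (((i : ℕ) + 1 : ℕ) : K),
      add_mem (IntermediateField.mem_adjoin_simple_self k t) (natCast_mem _ _)⟩
  have hb' : ∀ i, b i ^ 2 = algebraMap (IntermediateField.adjoin k {t}) K (a i) := hb
  have hns := aux_nonsq' t ht m a (fun _ => rfl)
  refine ⟨?_, ?_⟩
  · have := aux_finrank h2 b a hb' hns Finset.univ
    rwa [Finset.coe_univ, Set.image_univ, Finset.card_univ, Fintype.card_fin] at this
  · intro j₁ j₂ h12 hj
    refine lt_of_le_of_ne (IntermediateField.adjoin.mono _ _ _ ?_) ?_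
    · exact Set.union_subset_union_right _ (Set.image_mono fun i (hi : (i : ℕ) < j₁) => hi.trans h12)
    · intro heq
      have hn := aux_not_mem h2 b a hb' hns (Finset.univ.filter fun i : Fin m => (i : ℕ) < j₁)
        ⟨j₁, by omega⟩ (by simp)
      apply hn
      rw [← IntermediateField.mem_restrictScalars k, IntermediateField.adjoin_adjoin_left,
        Finset.coe_filter_univ, heq]
      exact IntermediateField.subset_adjoin _ _ (Or.inr ⟨⟨j₁, by omega⟩, h12, rfl⟩)
end

section
/- Let k ⊆ K be algebraically closed fields of characteristic 0 with k ≠ K, and let t ∈ K ∖ k. Set S = {b ∈ K : b² − t ∈ k}. Then there is no subfield F of K containing k that is finitely generated as a field extension of k and contains S. -/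
open Polynomial IntermediateField

lemma aux_trans {F K : Type*} [Field F] [Field K] [Algebra F K] (a : K)
    (ha : Transcendental F a) (x : F) (y : K) (hy : y ∈ F⟮a⟯) (h : y ^ 2 = algebraMap F K x) :
    ∃ p q : F[X], q ≠ 0 ∧ p ^ 2 = C x * q ^ 2 := by
  obtain ⟨p, q, rfl⟩ := (mem_adjoin_simple_iff F _).1 hy
  by_cases hq : aeval a q = 0
  · refine ⟨0, 1, one_ne_zero, ?_⟩
    have h0 : algebraMap F K x = 0 := by rw [← h, hq]; simp
    have : x = 0 := by simpa using h0
    simp [this]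
  · refine ⟨p, q, fun h => hq (by simp [h]), ?_⟩
    apply (transcendental_iff_injective.1 ha)
    simp only [map_mul, map_pow, aeval_C]
    rw [div_pow, div_eq_iff (pow_ne_zero 2 hq)] at h
    exact h

lemma aux_trans_sq {F K : Type*} [Field F] [Field K] [Algebra F K] (a : K)
    (ha : Transcendental F a) (x : F) (y : K) (hy : y ∈ F⟮a⟯) (h : y ^ 2 = algebraMap F K x) :
    ∃ z : F, z ^ 2 = x := by
  obtain ⟨p, q, hq, e⟩ := aux_trans a ha x y hy h
  refine ⟨p.leadingCoeff / q.leadingCoeff, ?_⟩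
  have := congrArg leadingCoeff e
  simp only [leadingCoeff_mul, leadingCoeff_pow, leadingCoeff_C] at this
  rw [div_pow, this, mul_div_cancel_right₀]
  exact pow_ne_zero 2 (leadingCoeff_ne_zero.2 hq)

lemma aux_base {k K : Type*} [Field k] [Field K] [Algebra k K] (t : K)
    (ht : Transcendental k t) (c d : k) (y : K) (hy : y ∈ k⟮t⟯)
    (h : y ^ 2 = (t + algebraMap k K c) * (t + algebraMap k K d)) : c = d := by
  by_contra hcd
  obtain ⟨p, q, rfl⟩ := (mem_adjoin_simple_iff k _).1 hy
  have hne : ∀ c : k, t + algebraMap k K c ≠ 0 := by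
    intro c hc
    apply ht
    exact ⟨X + C c, X_add_C_ne_zero c, by simpa using hc⟩
  by_cases hq : aeval t q = 0
  · have := mul_ne_zero (hne c) (hne d)
    simp [hq] at h
    simp_all
  have hq0 : q ≠ 0 := fun h => hq (by simp [h])
  have e : p ^ 2 = ((X - C (-c)) * (X - C (-d))) * q ^ 2 := by
    apply (transcendental_iff_injective.1 ht)
    rw [div_pow, div_eq_iff (pow_ne_zero 2 hq)] at h
    simpa using h
  have hr : ((X - C (-c)) * (X - C (-d))) * q ^ 2 ≠ 0 :=
    mul_ne_zero (mul_ne_zero (X_sub_C_ne_zero _) (X_sub_C_ne_zero _)) (pow_ne_zero 2 hq0)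
  have hp : p ^ 2 ≠ 0 := e ▸ hr
  have e2 := congrArg (rootMultiplicity (-c)) e
  rw [rootMultiplicity_mul hr, rootMultiplicity_mul (left_ne_zero_of_mul hr), pow_two,
    pow_two, rootMultiplicity_mul (by rwa [← pow_two]),
    rootMultiplicity_mul (mul_ne_zero hq0 hq0), rootMultiplicity_X_sub_C_self,
    rootMultiplicity_eq_zero (p := X - C (-d))] at e2
  · omega
  · simp only [IsRoot, eval_sub, eval_X, eval_C]
    intro h
    apply hcd
    linear_combination -h

lemma aux_lin {F L : Type*} [Field F] [Field L] [Algebra F L] (x : F) (y z : L)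
    (hy : y ^ 2 = algebraMap F L x) (hz : z ∈ F⟮y⟯) :
    ∃ a b : F, z = algebraMap F L a + algebraMap F L b * y := by
  have hm : (X ^ 2 - C x : F[X]).Monic := monic_X_pow_sub_C x two_ne_zero
  have hr : aeval y (X ^ 2 - C x : F[X]) = 0 := by simp [hy]
  have hint : IsIntegral F y := ⟨_, hm, hr⟩
  rw [← mem_toSubalgebra, adjoin_simple_toSubalgebra_of_isAlgebraic hint.isAlgebraic,
    Algebra.adjoin_singleton_eq_range_aeval] at hz
  obtain ⟨p, rfl⟩ := hz
  have h1 : (p %ₘ (X ^ 2 - C x)).degree < 2 := by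
    have := degree_modByMonic_lt p hm
    rwa [degree_X_pow_sub_C two_pos] at this
  have h2 : (p %ₘ (X ^ 2 - C x)).degree ≤ 1 := Order.le_of_lt_succ h1
  refine ⟨(p %ₘ (X ^ 2 - C x)).coeff 0, (p %ₘ (X ^ 2 - C x)).coeff 1, ?_⟩
  have h3 := eq_X_add_C_of_degree_le_one h2
  have h4 : aeval y p = aeval y (p %ₘ (X ^ 2 - C x)) := by
    conv_lhs => rw [← modByMonic_add_div p (X ^ 2 - C x)]
    simp only [map_add, map_mul, hr, zero_mul, add_zero]
  change aeval y p = _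
  rw [h4, h3]
  simp [add_comm]

/-- Square roots in the same quadratic extension. -/
lemma aux_quad {F L : Type*} [Field F] [Field L] [Algebra F L] [CharZero F] (x w : F) (y z : L)
    (hy : y ^ 2 = algebraMap F L x) (hz' : z ^ 2 = algebraMap F L w) (hz : z ∈ F⟮y⟯) :
    (∃ u : F, u ^ 2 = x) ∨ (∃ u : F, u ^ 2 = w) ∨ (∃ u : F, u ^ 2 = x * w) := by
  obtain ⟨a, b, rfl⟩ := aux_lin x y z hy hz
  have inj := (algebraMap F L).injective
  by_cases ha : a = 0
  · subst ha
    right; right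
    refine ⟨b * x, inj ?_⟩
    simp only [map_mul, map_pow, ← hz', ← hy]
    simp
    ring
  by_cases hb : b = 0
  · subst hb
    right; left
    refine ⟨a, inj ?_⟩
    rw [← hz']
    simp
  left
  have h2 : (2 * a * b : F) ≠ 0 := mul_ne_zero (mul_ne_zero two_ne_zero ha) hb
  have h3 : algebraMap F L (2 * a * b) ≠ 0 := by simpa using h2
  have h4 : algebraMap F L (2 * a * b) * y = algebraMap F L (w - a ^ 2 - b ^ 2 * x) := by
    simp only [map_mul, map_pow, map_sub, ← hz', ← hy, map_ofNat]
    ring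
  refine ⟨(w - a ^ 2 - b ^ 2 * x) / (2 * a * b), inj ?_⟩
  rw [← hy, map_pow, map_div₀, ← h4, mul_div_cancel_left₀ _ h3]

/-- The finiteness step for one algebraic generator. -/
lemma aux_alg {ι F K : Type*} [Field F] [Field K] [CharZero F] [Algebra F K] (f : ι → F)
    (hf0 : ∀ i, f i ≠ 0)
    (hf : ∀ c, {d | ∃ u : F, u ^ 2 = f c * f d}.Finite) (α : K) (hα : IsIntegral F α) (c : ι) :
    {d | ∃ y : K, y ∈ F⟮α⟯ ∧ y ^ 2 = algebraMap F K (f c * f d)}.Finite := by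
  by_contra hinf
  have hinf : Set.Infinite _ := hinf
  have hD := hinf.sdiff (hf c)
  have := adjoin.finiteDimensional hα
  have : Finite (IntermediateField F F⟮α⟯) :=
    Field.finite_intermediateField_of_exists_primitive_element F _
      (Field.exists_primitive_element F F⟮α⟯)
  set D := {d | ∃ y : K, y ∈ F⟮α⟯ ∧ y ^ 2 = algebraMap F K (f c * f d)} \
    {d | ∃ u : F, u ^ 2 = f c * f d} with hDdef
  have hy : ∀ d : D, ∃ y : F⟮α⟯, y ^ 2 = algebraMap F F⟮α⟯ (f c * f d) := by
    rintro ⟨d, ⟨y, hy, h⟩, _⟩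
    exact ⟨⟨y, hy⟩, Subtype.ext h⟩
  choose Y hY using hy
  have : Infinite D := hD.to_subtype
  obtain ⟨E, hE⟩ := Finite.exists_infinite_fiber (fun d : D => F⟮Y d⟯)
  have := hE
  obtain ⟨d₀, hd₀⟩ := (inferInstance : Nonempty ((fun d : D => F⟮Y d⟯) ⁻¹' {E}))
  have hfin := hf d₀
  have hinj : Function.Injective
      (fun e : ((fun d : D => F⟮Y d⟯) ⁻¹' {E}) => ((e : D) : ι)) :=
    Subtype.val_injective.comp Subtype.val_injective
  refine Set.infinite_range_of_injective hinj (hfin.subset ?_)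
  rintro _ ⟨⟨d, hd⟩, rfl⟩
  have hmem : Y d ∈ F⟮Y d₀⟯ := by
    have h1 : F⟮Y d⟯ = F⟮Y d₀⟯ := by
      have a1 : F⟮Y d⟯ = E := hd
      have a2 : F⟮Y d₀⟯ = E := hd₀
      rw [a1, a2]
    rw [← h1]
    exact mem_adjoin_simple_self F _
  rcases aux_quad _ _ _ _ (hY d₀) (hY d) hmem with h | h | ⟨u, h⟩
  · exact absurd h d₀.2.2
  · exact absurd h d.2.2
  · refine ⟨u / f c, ?_⟩
    rw [div_pow, h]
    have := hf0 c
    field_simp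

/-- Let `k ⊆ K` be algebraically closed fields of characteristic `0` with `k ≠ K`, let
`t ∈ K ∖ k`, and let `S = {b ∈ K : b² − t ∈ k}`. Then no subfield of `K` containing `k`
that is finitely generated as a field extension of `k` contains `S`. -/
theorem no_finitely_generated_subfield_contains_S
    {K : Type*} [Field K] [IsAlgClosed K] [CharZero K]
    (k : Subfield K) [IsAlgClosed k] (hk : k ≠ ⊤)
    (t : K) (ht : t ∉ k) :
    ¬ ∃ F : Subfield K, k ≤ F ∧
      (∃ (n : ℕ) (a : Fin n → K), F = Subfield.closure ((k : Set K) ∪ Set.range a)) ∧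
      {b : K | b ^ 2 - t ∈ k} ⊆ (F : Set K) := by
  rintro ⟨F, hkF, ⟨n, a, hFa⟩, hS⟩
  have htr : Transcendental k t := by
    intro h
    obtain ⟨x, hx⟩ := minpoly.mem_range_of_degree_eq_one k t
      (IsAlgClosed.degree_eq_one_of_irreducible k (minpoly.irreducible h.isIntegral))
    exact ht (hx ▸ x.2)
  have hne : ∀ c : k, t + (c : K) ≠ 0 := by
    intro c hc
    apply ht
    rw [eq_neg_of_add_eq_zero_left hc]
    exact k.neg_mem c.2
  have key : ∀ L : IntermediateField k⟮t⟯ K, L.FG →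
      ∀ c : k, {d : k | ∃ y : K, y ∈ L ∧ y ^ 2 = (t + (c : K)) * (t + (d : K))}.Finite := by
    intro L hL
    refine induction_on_adjoin_fg
      (P := fun L : IntermediateField k⟮t⟯ K => ∀ c : k,
        {d : k | ∃ y : K, y ∈ L ∧ y ^ 2 = (t + (c : K)) * (t + (d : K))}.Finite) ?_ ?_ L hL
    · intro c
      refine (Set.finite_singleton c).subset ?_
      rintro d ⟨y, hy, h⟩
      obtain ⟨z, rfl⟩ := mem_bot.1 hy
      exact (aux_base t htr c d _ z.2 h).symm
    · intro L x ih c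
      have htL : ∀ c : k, t + (c : K) ∈ L := fun c =>
        L.algebraMap_mem (⟨t + c, add_mem (mem_adjoin_simple_self k t)
          (IntermediateField.algebraMap_mem _ c)⟩ : k⟮t⟯)
      let f : k → L := fun c => ⟨t + c, htL c⟩
      have hf0 : ∀ i, f i ≠ 0 := fun i h => hne i (congrArg Subtype.val h)
      have hf : ∀ c, {d | ∃ u : L, u ^ 2 = f c * f d}.Finite := by
        intro c
        refine (ih c).subset ?_
        rintro d ⟨u, hu⟩
        exact ⟨u, u.2, congrArg Subtype.val hu⟩
      by_cases hx : IsIntegral L x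
      · exact aux_alg f hf0 hf x hx c
      · refine (hf c).subset ?_
        rintro d ⟨y, hy, h⟩
        exact aux_trans_sq x (fun h => hx h.isIntegral) (f c * f d) y hy h
  have hfg : (adjoin k⟮t⟯ (Set.range a)).FG := fg_def.2 ⟨_, Set.finite_range a, rfl⟩
  have hle : F ≤ (adjoin k⟮t⟯ (Set.range a)).toSubfield := by
    rw [hFa, Subfield.closure_le]
    rintro z (hz | hz)
    · exact IntermediateField.algebraMap_mem (adjoin k⟮t⟯ (Set.range a))
        (⟨z, IntermediateField.algebraMap_mem k⟮t⟯ (⟨z, hz⟩ : k)⟩ : k⟮t⟯)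
    · exact subset_adjoin _ _ hz
  have hroot : ∀ c : k, ∃ y ∈ adjoin k⟮t⟯ (Set.range a), y ^ 2 = t + (c : K) := by
    intro c
    obtain ⟨y, hy⟩ := IsAlgClosed.exists_pow_nat_eq (t + (c : K)) (n := 2) two_pos
    refine ⟨y, hle (hS ?_), hy⟩
    simp [hy]
  have : Infinite k := IsAlgClosed.instInfinite
  refine Set.infinite_univ (α := k) ((key _ hfg 0).subset ?_)
  intro d _
  obtain ⟨y, hy, h⟩ := hroot 0
  obtain ⟨z, hz, h'⟩ := hroot d
  exact ⟨y * z, mul_mem hy hz, by rw [mul_pow, h, h']⟩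
end
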